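/- arXiv:2107.09100 — 2 statements merged into one kernel-verified Lean document; each statement's English description precedes it below -/
import Mathlib

section
/- Let m : ℝⁿ → ℂ be a smooth function such that the pointwise product m·ψ is a Schwartz function for every Schwartz function ψ : ℝⁿ → ℂ. Then m has temperate growth: for every multi-index β ∈ ℕ₀ⁿ there exist a natural number α and a constant C such that |∂^β m(x)| ≤ C (1+|x|²)^{α/2} for all x ∈ ℝⁿ. Hence the set of multipliers of 𝓢(ℝⁿ) is contained in O_M(ℝⁿ). -/
open MeasureTheory Filter

noncomputable def pd {n : ℕ} (i : Fin n) (f : EuclideanSpace ℝ (Fin n) → ℂ) :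
    EuclideanSpace ℝ (Fin n) → ℂ :=
  fun x => fderiv ℝ f x (EuclideanSpace.single i 1)

/-- The multi-index partial derivative `∂^β f` for a multi-index `β ∈ ℕ₀ⁿ`. -/
noncomputable def mderiv {n : ℕ} (β : Fin n → ℕ) (f : EuclideanSpace ℝ (Fin n) → ℂ) :
    EuclideanSpace ℝ (Fin n) → ℂ :=
  ((List.finRange n).foldr (fun i g => (pd i)^[β i] ∘ g) id) f

namespace SchwartzMap

open scoped SchwartzMap

variable {E F : Type*} [NormedAddCommGroup E] [NormedSpace ℝ E]
  [NormedAddCommGroup F] [NormedSpace ℝ F]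

/-- A series of Schwartz functions all of whose seminorms are summable converges pointwise to a
Schwartz function. -/
theorem exists_hasSum_of_summable_seminorm [CompleteSpace F] {f : ℕ → 𝓢(E, F)}
    (hf : ∀ k n, Summable fun i => SchwartzMap.seminorm ℝ k n (f i)) :
    ∃ g : 𝓢(E, F), ∀ x, HasSum (fun i => f i x) (g x) := by
  have hbound : ∀ (n i : ℕ) (x : E),
      ‖iteratedFDeriv ℝ n (f i) x‖ ≤ SchwartzMap.seminorm ℝ 0 n (f i) :=
    fun n i x => norm_iteratedFDeriv_le_seminorm ℝ (f i) n x
  have hsum (x : E) : Summable fun i => f i x :=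
    .of_norm_bounded (hf 0 0) fun i => norm_le_seminorm ℝ (f i) x
  refine ⟨⟨fun x => ∑' i, f i x, ?_, fun k n => ?_⟩, fun x => (hsum x).hasSum⟩
  · exact contDiff_tsum (N := (⊤ : ℕ∞)) (fun i => (f i).smooth ⊤) (fun n _ => hf 0 n)
      fun n i x _ => hbound n i x
  · refine ⟨∑' i, SchwartzMap.seminorm ℝ k n (f i), fun x => ?_⟩
    rw [iteratedFDeriv_tsum_apply (N := (⊤ : ℕ∞)) (fun i => (f i).smooth ⊤) (fun n _ => hf 0 n)
      (fun n i x _ => hbound n i x) le_top, ← norm_norm x, ← norm_pow, ← norm_smul,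
      ← tsum_const_smul'']
    refine tsum_of_norm_bounded (hf k n).hasSum fun i => ?_
    rw [norm_smul, norm_pow, norm_norm]
    exact le_seminorm ℝ k n (f i) x

/-- The seminorms of the translates of a Schwartz function grow at most polynomially in the
translation vector. -/
theorem exists_seminorm_compSubConstCLM_le (f : 𝓢(E, F)) (k n : ℕ) :
    ∃ C : ℝ, ∀ a : E,
      SchwartzMap.seminorm ℝ k n (compSubConstCLM ℝ a f) ≤ C * (1 + ‖a‖) ^ k := by
  set C : ℝ :=
    2 ^ k * (Finset.Iic (k, n)).sup (fun m => SchwartzMap.seminorm ℝ (E := E) (F := F) m.1 m.2) f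
  have hC : 0 ≤ C := by positivity
  refine ⟨C, fun a => seminorm_le_bound ℝ k n _ (by positivity) fun x => ?_⟩
  have hderiv : iteratedFDeriv ℝ n (compSubConstCLM ℝ a f) x = iteratedFDeriv ℝ n f (x - a) :=
    iteratedFDeriv_comp_sub n a x
  have hx : ‖x‖ ≤ (1 + ‖x - a‖) * (1 + ‖a‖) := by
    have h₁ : ‖x‖ ≤ ‖x - a‖ + ‖a‖ := norm_le_norm_sub_add x a
    nlinarith [norm_nonneg (x - a), norm_nonneg a]
  calc ‖x‖ ^ k * ‖iteratedFDeriv ℝ n (compSubConstCLM ℝ a f) x‖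
      ≤ ((1 + ‖x - a‖) * (1 + ‖a‖)) ^ k * ‖iteratedFDeriv ℝ n f (x - a)‖ := by
        rw [hderiv]; gcongr
    _ = (1 + ‖x - a‖) ^ k * ‖iteratedFDeriv ℝ n f (x - a)‖ * (1 + ‖a‖) ^ k := by
        rw [mul_pow]; ring
    _ ≤ C * (1 + ‖a‖) ^ k := by
        gcongr
        exact one_add_le_sup_seminorm_apply (𝕜 := ℝ) (m := (k, n)) le_rfl le_rfl f (x - a)

/-- For any sequence of points `a`, there is a Schwartz function whose value at `a k` is at least
`(2 * (1 + ‖a k‖)) ^ (-k)`. -/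
theorem exists_forall_inv_pow_le [FiniteDimensional ℝ E] (a : ℕ → E) :
    ∃ g : 𝓢(E, ℝ), ∀ k, ((2 * (1 + ‖a k‖)) ^ k)⁻¹ ≤ g (a k) := by
  let ρ : ContDiffBump (0 : E) := default
  let f : 𝓢(E, ℝ) := ρ.hasCompactSupport.toSchwartzMap ρ.contDiff
  have hf (x : E) : f x = ρ x := rfl
  obtain ⟨g, hg⟩ := exists_hasSum_of_summable_seminorm
    (f := fun i => ((2 * (1 + ‖a i‖)) ^ i)⁻¹ • compSubConstCLM ℝ (a i) f) fun k n => by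
      obtain ⟨C, hC⟩ := exists_seminorm_compSubConstCLM_le f k n
      have hgeom : Summable fun i : ℕ => C * (1 / 2 : ℝ) ^ i :=
        summable_geometric_two.mul_left C
      refine hgeom.of_norm_bounded_eventually_nat ?_
      filter_upwards [eventually_ge_atTop k] with i hi
      have hC₀ : 0 ≤ C := by simpa using (apply_nonneg _ _).trans (hC 0)
      rw [Real.norm_of_nonneg (apply_nonneg _ _), map_smul_eq_mul,
        Real.norm_of_nonneg (by positivity)]
      calc ((2 * (1 + ‖a i‖)) ^ i)⁻¹ * SchwartzMap.seminorm ℝ k n (compSubConstCLM ℝ (a i) f)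
          ≤ ((2 * (1 + ‖a i‖)) ^ i)⁻¹ * (C * (1 + ‖a i‖) ^ i) := by
            grw [hC (a i)]
            gcongr
            linarith [norm_nonneg (a i)]
        _ = C * (1 / 2 : ℝ) ^ i := by
            have : 1 + ‖a i‖ ≠ 0 := by positivity
            rw [mul_pow, one_div, inv_pow]
            field_simp
  refine ⟨g, fun k => ?_⟩
  have hk := le_hasSum (hg (a k)) k fun i _ => by
    simpa [hf] using mul_nonneg (by positivity) ρ.nonneg
  have hρ : ρ 0 = 1 := ρ.one_of_mem_closedBall (by simp [ρ.rIn_pos.le])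
  simpa [hf, hρ] using hk

end SchwartzMap

/-- A function is a multiplier of the Schwartz space if it is smooth and its product with any
Schwartz function is a Schwartz function. -/
def IsSchwartzMultiplier {E : Type*} [NormedAddCommGroup E] [NormedSpace ℝ E] (m : E → ℂ) : Prop :=
  ContDiff ℝ (⊤ : ℕ∞) m ∧ ∀ ψ : SchwartzMap E ℂ, ∃ φ : SchwartzMap E ℂ, ∀ x, m x * ψ x = φ x

namespace IsSchwartzMultiplier

open LineDeriv

variable {E : Type*} [NormedAddCommGroup E] [NormedSpace ℝ E] {m : E → ℂ}

theorem fderiv_apply (hm : IsSchwartzMultiplier m) (v : E) :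
    IsSchwartzMultiplier fun x => fderiv ℝ m x v := by
  refine ⟨(hm.1.fderiv_right (m := (⊤ : ℕ∞)) (by simp)).clm_apply contDiff_const, fun ψ => ?_⟩
  obtain ⟨φ₁, hφ₁⟩ := hm.2 ψ
  obtain ⟨φ₂, hφ₂⟩ := hm.2 (∂_{v} ψ)
  refine ⟨∂_{v} φ₁ - φ₂, fun x => ?_⟩
  have hmx : DifferentiableAt ℝ m x := hm.1.differentiable (by simp) x
  rw [sub_apply, ← hφ₂, SchwartzMap.lineDerivOp_apply_eq_fderiv,
    SchwartzMap.lineDerivOp_apply_eq_fderiv, ← funext hφ₁, fderiv_fun_mul hmx ψ.differentiableAt]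
  simp only [add_apply, smul_apply, smul_eq_mul]
  ring

theorem exists_norm_le [FiniteDimensional ℝ E] (hm : IsSchwartzMultiplier m) :
    ∃ k : ℕ, ∀ x, ‖m x‖ ≤ k * (2 * (1 + ‖x‖)) ^ k := by
  by_contra! h
  choose a ha using h
  obtain ⟨g, hg⟩ := SchwartzMap.exists_forall_inv_pow_le a
  obtain ⟨φ, hφ⟩ := hm.2 (g.postcompCLM Complex.ofRealCLM)
  obtain ⟨k, hk⟩ := exists_nat_gt (SchwartzMap.seminorm ℝ 0 0 φ)
  refine hk.not_ge ?_
  have hpos : 0 < (2 * (1 + ‖a k‖)) ^ k := by positivity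
  calc (k : ℝ) = k * (2 * (1 + ‖a k‖)) ^ k * ((2 * (1 + ‖a k‖)) ^ k)⁻¹ :=
        (mul_inv_cancel_right₀ hpos.ne' _).symm
    _ ≤ ‖m (a k)‖ * ‖g (a k)‖ := by
        gcongr
        · exact (ha k).le
        · exact (hg k).trans (le_abs_self _)
    _ = ‖φ (a k)‖ := by simp [← hφ]
    _ ≤ SchwartzMap.seminorm ℝ 0 0 φ := SchwartzMap.norm_le_seminorm ℝ φ (a k)

theorem mderiv {n : ℕ} {m : EuclideanSpace ℝ (Fin n) → ℂ} (hm : IsSchwartzMultiplier m)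
    (β : Fin n → ℕ) : IsSchwartzMultiplier (mderiv β m) := by
  unfold _root_.mderiv
  induction List.finRange n with
  | nil => exact hm
  | cons i l ih =>
    rw [List.foldr_cons, Function.comp_apply]
    exact Function.Iterate.rec IsSchwartzMultiplier ih (fun _ h => h.fderiv_apply _) (β i)

end IsSchwartzMultiplier

/-- If `m : ℝⁿ → ℂ` is a smooth multiplier of the Schwartz space (i.e. `m·ψ ∈ 𝓢(ℝⁿ)` for
every `ψ ∈ 𝓢(ℝⁿ)`), then `m` has temperate growth: every derivative `∂^β m` grows at most
polynomially. Hence `m(ℝⁿ) ⊆ O_M(ℝⁿ)`. -/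
theorem multipliers_subset_OM (n : ℕ) (m : EuclideanSpace ℝ (Fin n) → ℂ)
    (hm : ContDiff ℝ (⊤ : ℕ∞) m)
    (hmul : ∀ ψ : SchwartzMap (EuclideanSpace ℝ (Fin n)) ℂ,
      ∃ φ : SchwartzMap (EuclideanSpace ℝ (Fin n)) ℂ, ∀ x, m x * ψ x = φ x) :
    ∀ β : Fin n → ℕ, ∃ (α : ℕ) (C : ℝ), ∀ x,
      ‖mderiv β m x‖ ≤ C * (1 + ‖x‖^2) ^ ((α:ℝ)/2) := by
  intro β
  obtain ⟨k, hk⟩ := (IsSchwartzMultiplier.mderiv ⟨hm, hmul⟩ β).exists_norm_le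
  refine ⟨2 * k, k * 4 ^ k, fun x => (hk x).trans ?_⟩
  have hexp : ((2 * k : ℕ) : ℝ) / 2 = k := by push_cast; ring
  have hx : 2 * (1 + ‖x‖) ≤ 4 * (1 + ‖x‖ ^ 2) := by nlinarith [sq_nonneg (‖x‖ - 1)]
  rw [hexp, Real.rpow_natCast, mul_assoc, ← mul_pow]
  exact mul_le_mul_of_nonneg_left (pow_le_pow_left₀ (by positivity) hx k) k.cast_nonneg
end

section
/- A smooth function m : ℝⁿ → ℂ is a multiplier of the Schwartz space (i.e. m·ψ ∈ 𝓢(ℝⁿ) for every ψ ∈ 𝓢(ℝⁿ)) if and only if m has temperate growth (i.e. m ∈ O_M(ℝⁿ)). In symbols, m(ℝⁿ) = O_M(ℝⁿ). -/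
open MeasureTheory Filter

section SchwartzSeries

variable {E F : Type*} [NormedAddCommGroup E] [NormedSpace ℝ E]
  [NormedAddCommGroup F] [NormedSpace ℝ F]

/-- A series of Schwartz functions converging absolutely in every Schwartz seminorm has a Schwartz
function as its pointwise sum. -/
theorem SchwartzMap.exists_hasSum_apply [CompleteSpace F] (f : ℕ → SchwartzMap E F)
    (hf : ∀ k l, Summable fun i => SchwartzMap.seminorm ℝ k l (f i)) :
    ∃ ψ : SchwartzMap E F, ∀ y, HasSum (fun i => f i y) (ψ y) := by
  have hsm : ∀ i, ContDiff ℝ (⊤ : ℕ∞) (f i) := fun i => (f i).smooth ⊤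
  have hv : ∀ k : ℕ, (k : ℕ∞) ≤ ⊤ → Summable fun i => SchwartzMap.seminorm ℝ 0 k (f i) :=
    fun k _ => hf 0 k
  have hb : ∀ (k : ℕ) (i : ℕ) (x : E), (k : ℕ∞) ≤ ⊤ →
      ‖iteratedFDeriv ℝ k (f i) x‖ ≤ SchwartzMap.seminorm ℝ 0 k (f i) :=
    fun k i x _ => SchwartzMap.norm_iteratedFDeriv_le_seminorm ℝ (f i) k x
  refine ⟨⟨fun y => ∑' i, f i y, contDiff_tsum hsm hv hb, fun k l =>
    ⟨∑' i, SchwartzMap.seminorm ℝ k l (f i), fun x => ?_⟩⟩, fun y => ?_⟩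
  · rw [iteratedFDeriv_tsum_apply hsm hv hb le_top]
    have hs : Summable fun i => ‖iteratedFDeriv ℝ l (f i) x‖ :=
      (hf 0 l).of_nonneg_of_le (fun i => norm_nonneg _) fun i => hb l i x le_top
    calc ‖x‖ ^ k * ‖∑' i, iteratedFDeriv ℝ l (f i) x‖
        ≤ ‖x‖ ^ k * ∑' i, ‖iteratedFDeriv ℝ l (f i) x‖ := by
          gcongr
          exact norm_tsum_le_tsum_norm hs
      _ = ∑' i, ‖x‖ ^ k * ‖iteratedFDeriv ℝ l (f i) x‖ := tsum_mul_left.symm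
      _ ≤ _ := (hs.mul_left _).tsum_le_tsum
          (fun i => SchwartzMap.le_seminorm ℝ k l (f i) x) (hf k l)
  · exact ((hf 0 0).of_norm_bounded
      fun i => SchwartzMap.norm_le_seminorm ℝ (f i) y).hasSum

/-- The Schwartz seminorms of the translates of a Schwartz function grow polynomially. -/
theorem SchwartzMap.exists_seminorm_compSubConstCLM_le_s4 (φ : SchwartzMap E F) (k l : ℕ) :
    ∃ C, 0 ≤ C ∧ ∀ a : E,
      SchwartzMap.seminorm ℝ k l (φ.compSubConstCLM ℝ a) ≤ C * (1 + ‖a‖) ^ k := by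
  refine ⟨2 ^ k * (Finset.Iic (k, l)).sup (fun m => SchwartzMap.seminorm ℝ m.1 m.2) φ,
    by positivity, fun a => ?_⟩
  refine SchwartzMap.seminorm_le_bound ℝ k l _ (by positivity) fun x => ?_
  have h1 := SchwartzMap.one_add_le_sup_seminorm_apply (𝕜 := ℝ) (m := (k, l)) le_rfl le_rfl φ
    (x - a)
  have h2 : iteratedFDeriv ℝ l (φ.compSubConstCLM ℝ a) x = iteratedFDeriv ℝ l φ (x - a) :=
    iteratedFDeriv_comp_sub l a x
  have h3 : ‖x‖ ≤ (1 + ‖x - a‖) * (1 + ‖a‖) := by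
    have := norm_add_le (x - a) a
    rw [sub_add_cancel] at this
    nlinarith [norm_nonneg (x - a), norm_nonneg a]
  rw [h2]
  calc ‖x‖ ^ k * ‖iteratedFDeriv ℝ l φ (x - a)‖
      ≤ ((1 + ‖x - a‖) * (1 + ‖a‖)) ^ k * ‖iteratedFDeriv ℝ l φ (x - a)‖ := by gcongr
    _ = ((1 + ‖x - a‖) ^ k * ‖iteratedFDeriv ℝ l φ (x - a)‖) * (1 + ‖a‖) ^ k := by
        rw [mul_pow, mul_right_comm]
    _ ≤ _ := by gcongr

/-- Along every sequence of points there is a Schwartz function with an explicit lower bound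
that beats every polynomial growth rate. -/
theorem SchwartzMap.exists_forall_inv_le_norm [FiniteDimensional ℝ E] (x : ℕ → E) :
    ∃ ψ : SchwartzMap E ℂ, ∀ k, ((2 * (1 + ‖x k‖)) ^ k)⁻¹ ≤ ‖ψ (x k)‖ := by
  let b : ContDiffBump (0 : E) := default
  have hcs : HasCompactSupport fun y => (b y : ℂ) :=
    b.hasCompactSupport.comp_left Complex.ofReal_zero
  let φ : SchwartzMap E ℂ :=
    hcs.toSchwartzMap (Complex.ofRealCLM.contDiff.comp b.contDiff)
  have hφ : ∀ y, φ y = (b y : ℂ) := fun _ => rfl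
  let c : ℕ → ℝ := fun i => ((2 * (1 + ‖x i‖)) ^ i)⁻¹
  have hc : ∀ i, 0 ≤ c i := fun i => by positivity
  obtain ⟨ψ, hψ⟩ := SchwartzMap.exists_hasSum_apply
    (fun i => c i • φ.compSubConstCLM ℝ (x i)) fun k l => by
      obtain ⟨C, hC, h⟩ := φ.exists_seminorm_compSubConstCLM_le_s4 k l
      rw [← summable_nat_add_iff k]
      refine Summable.of_nonneg_of_le (fun i => by positivity) (fun i => ?_)
        ((summable_geometric_of_lt_one (r := (1 / 2 : ℝ)) (by norm_num) (by norm_num)).mul_left C)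
      have h1 : (1 : ℝ) ≤ 1 + ‖x (i + k)‖ := by simp
      rw [map_smul_eq_mul, Real.norm_of_nonneg (hc _)]
      calc c (i + k) * SchwartzMap.seminorm ℝ k l (φ.compSubConstCLM ℝ (x (i + k)))
          ≤ c (i + k) * (C * (1 + ‖x (i + k)‖) ^ k) := by gcongr; exact h _
        _ = C * ((2 ^ (i + k))⁻¹ * ((1 + ‖x (i + k)‖) ^ i)⁻¹) := by
            simp only [c, mul_pow, pow_add]
            field_simp
        _ ≤ C * ((2 ^ i)⁻¹ * 1) := by
            gcongr
            · norm_num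
            · omega
            · exact inv_le_one_of_one_le₀ (one_le_pow₀ h1)
        _ = C * (1 / 2) ^ i := by simp
  refine ⟨ψ, fun k => le_trans ?_ (Complex.re_le_norm _)⟩
  have hre := Complex.hasSum_re (hψ (x k))
  have hterm : ∀ i, ((c i • φ.compSubConstCLM ℝ (x i)) (x k)).re = c i * b (x k - x i) := by
    intro i
    simp [hφ]
  simp only [hterm] at hre
  have hone : b (x k - x k) = 1 := by
    rw [sub_self]
    exact b.one_of_mem_closedBall (by simpa using b.rIn_pos.le)
  have := le_hasSum hre k fun i _ => mul_nonneg (hc i) b.nonneg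
  rwa [hone, mul_one] at this

/-- A function whose product with every Schwartz function is bounded grows at most
polynomially. -/
theorem exists_norm_le_mul_one_add_norm_pow [FiniteDimensional ℝ E] (f : E → ℂ)
    (hf : ∀ ψ : SchwartzMap E ℂ, ∃ C, ∀ x, ‖f x * ψ x‖ ≤ C) :
    ∃ (k : ℕ) (C : ℝ), ∀ x, ‖f x‖ ≤ C * (1 + ‖x‖) ^ k := by
  by_contra! h
  choose x hx using fun k : ℕ => h k (2 ^ k * k)
  obtain ⟨ψ, hψ⟩ := SchwartzMap.exists_forall_inv_le_norm x
  obtain ⟨C, hC⟩ := hf ψ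
  obtain ⟨k, hk⟩ := exists_nat_gt C
  refine (hk.trans_le ?_).not_ge (hC (x k))
  rw [norm_mul]
  calc (k : ℝ) = (2 ^ k * k * (1 + ‖x k‖) ^ k) * ((2 * (1 + ‖x k‖)) ^ k)⁻¹ := by
        rw [mul_pow]
        field_simp
    _ ≤ _ := mul_le_mul (hx k).le (hψ k) (by positivity) (norm_nonneg _)

end SchwartzSeries

section JapaneseBracket

theorem exists_le_mul_one_add_norm_sq_rpow_iff {E : Type*} [NormedAddCommGroup E] (g : E → ℝ) :
    (∃ (α : ℕ) (C : ℝ), ∀ x, g x ≤ C * (1 + ‖x‖ ^ 2) ^ ((α : ℝ) / 2)) ↔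
      ∃ (k : ℕ) (C : ℝ), ∀ x, g x ≤ C * (1 + ‖x‖) ^ k := by
  constructor
  · rintro ⟨α, C, h⟩
    refine ⟨α, |C|, fun x => (h x).trans ?_⟩
    have hx := norm_nonneg x
    have h1 : (1 + ‖x‖ ^ 2) ^ ((α : ℝ) / 2) ≤ (1 + ‖x‖) ^ α := by
      calc (1 + ‖x‖ ^ 2) ^ ((α : ℝ) / 2) ≤ ((1 + ‖x‖) ^ 2) ^ ((α : ℝ) / 2) := by
            gcongr
            nlinarith
        _ = (1 + ‖x‖) ^ α := by
            rw [← Real.rpow_natCast, ← Real.rpow_mul (by positivity), ← Real.rpow_natCast]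
            congr 1
            push_cast
            ring
    exact mul_le_mul (le_abs_self C) h1 (by positivity) (abs_nonneg C)
  · rintro ⟨k, C, h⟩
    refine ⟨2 * k, |C| * 2 ^ k, fun x => (h x).trans ?_⟩
    have hx := norm_nonneg x
    have h1 : (1 + ‖x‖) ^ k ≤ 2 ^ k * (1 + ‖x‖ ^ 2) ^ (((2 * k : ℕ) : ℝ) / 2) := by
      have : ((2 * k : ℕ) : ℝ) / 2 = (k : ℝ) := by push_cast; ring
      rw [this, Real.rpow_natCast, ← mul_pow]
      gcongr
      nlinarith [sq_nonneg (‖x‖ - 1)]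
    rw [mul_assoc]
    exact mul_le_mul (le_abs_self C) h1 (by positivity) (abs_nonneg C)

end JapaneseBracket

section PartialDerivatives

variable {n : ℕ} {f : EuclideanSpace ℝ (Fin n) → ℂ}

theorem contDiff_pd (i : Fin n) (hf : ContDiff ℝ (⊤ : ℕ∞) f) :
    ContDiff ℝ (⊤ : ℕ∞) (pd i f) :=
  (hf.fderiv_right (by simp)).clm_apply contDiff_const

theorem pd_comm (i j : Fin n) (hf : ContDiff ℝ (⊤ : ℕ∞) f) :
    pd i (pd j f) = pd j (pd i f) := by
  have hd : Differentiable ℝ (fderiv ℝ f) :=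
    (hf.fderiv_right (m := (⊤ : ℕ∞)) (by simp)).differentiable (by simp)
  have key : ∀ (v w x : EuclideanSpace ℝ (Fin n)),
      fderiv ℝ (fun y => fderiv ℝ f y v) x w = fderiv ℝ (fderiv ℝ f) x w v := by
    intro v w x
    rw [fderiv_clm_apply (hd x) (differentiableAt_const v)]
    simp
  funext x
  refine (key _ _ x).trans (Eq.trans ?_ (key _ _ x).symm)
  exact (hf.contDiffAt.isSymmSndFDerivAt (by
    simpa using WithTop.coe_le_coe.2 (le_top : (2 : ℕ∞) ≤ ⊤))).eq _ _

/-- A property preserved by first-order partial derivatives is preserved by `∂^β`. -/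
theorem mderiv_induction (P : (EuclideanSpace ℝ (Fin n) → ℂ) → Prop)
    (hP : ∀ i g, P g → P (pd i g)) (β : Fin n → ℕ) (hf : P f) : P (mderiv β f) := by
  unfold mderiv
  induction List.finRange n with
  | nil => exact hf
  | cons i l ih =>
    simp only [List.foldr_cons, Function.comp_apply]
    generalize List.foldr _ id l f = g at ih
    induction β i with
    | zero => exact ih
    | succ k hk =>
      rw [Function.iterate_succ_apply']
      exact hP i _ hk

theorem mderiv_zero : mderiv 0 f = f := by
  unfold mderiv
  induction List.finRange n with
  | nil => rfl
  | cons i l ih => simp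

theorem contDiff_iterate_pd (i : Fin n) (k : ℕ) (hf : ContDiff ℝ (⊤ : ℕ∞) f) :
    ContDiff ℝ (⊤ : ℕ∞) ((pd i)^[k] f) := by
  induction k with
  | zero => exact hf
  | succ k hk =>
    rw [Function.iterate_succ_apply']
    exact contDiff_pd i hk

theorem iterate_pd_pd (i j : Fin n) (k : ℕ) (hf : ContDiff ℝ (⊤ : ℕ∞) f) :
    (pd i)^[k] (pd j f) = pd j ((pd i)^[k] f) := by
  induction k with
  | zero => rfl
  | succ k hk =>
    rw [Function.iterate_succ_apply', Function.iterate_succ_apply', hk,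
      pd_comm i j (contDiff_iterate_pd i k hf)]

theorem mderiv_pd (β : Fin n → ℕ) (j : Fin n) (hf : ContDiff ℝ (⊤ : ℕ∞) f) :
    mderiv β (pd j f) = mderiv (β + Pi.single j 1) f := by
  have hsm : ∀ l : List (Fin n), ContDiff ℝ (⊤ : ℕ∞)
      (l.foldr (fun i g => (pd i)^[β i] ∘ g) id f) := by
    intro l
    induction l with
    | nil => exact hf
    | cons i l ih => exact contDiff_iterate_pd i _ ih
  have hcomm : ∀ l : List (Fin n), l.foldr (fun i g => (pd i)^[β i] ∘ g) id (pd j f) =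
      pd j (l.foldr (fun i g => (pd i)^[β i] ∘ g) id f) := by
    intro l
    induction l with
    | nil => rfl
    | cons i l ih =>
      simp only [List.foldr_cons, Function.comp_apply]
      rw [ih, iterate_pd_pd i j _ (hsm l)]
  have hnot : ∀ l : List (Fin n), j ∉ l →
      l.foldr (fun i g => (pd i)^[(β + Pi.single j 1 : Fin n → ℕ) i] ∘ g) id f =
      l.foldr (fun i g => (pd i)^[β i] ∘ g) id f := by
    intro l hl
    induction l with
    | nil => rfl
    | cons i l ih =>
      rw [List.mem_cons, not_or] at hl
      simp only [List.foldr_cons, Function.comp_apply]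
      rw [ih hl.2]
      simp [Ne.symm hl.1]
  have hmem : ∀ l : List (Fin n), l.Nodup → j ∈ l →
      l.foldr (fun i g => (pd i)^[(β + Pi.single j 1 : Fin n → ℕ) i] ∘ g) id f =
      pd j (l.foldr (fun i g => (pd i)^[β i] ∘ g) id f) := by
    intro l hl hj
    induction l with
    | nil => simp at hj
    | cons i l ih =>
      rw [List.nodup_cons] at hl
      simp only [List.foldr_cons, Function.comp_apply]
      by_cases hij : j = i
      · subst hij
        rw [hnot l hl.1]
        simp [Function.iterate_succ_apply']
      · rw [ih hl.2 ((List.mem_cons.1 hj).resolve_left hij)]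
        rw [← iterate_pd_pd i j _ (hsm l)]
        simp [Ne.symm hij]
  exact (hcomm _).trans (hmem _ (List.nodup_finRange n) (List.mem_finRange j)).symm

theorem fderiv_eq_sum_pd (f : EuclideanSpace ℝ (Fin n) → ℂ) :
    fderiv ℝ f = ∑ i, ContinuousLinearMap.smulRightL ℝ (EuclideanSpace ℝ (Fin n)) ℂ
      (EuclideanSpace.proj i) ∘ pd i f := by
  funext x
  ext v
  have hv : v = ∑ i, v i • EuclideanSpace.single i (1 : ℝ) := by
    ext j
    simp [Pi.single_apply]
  conv_lhs => rw [hv, map_sum]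
  simp [pd]

/-- A smooth function all of whose partial derivatives are polynomially bounded has temperate
growth. -/
theorem hasTemperateGrowth_of_mderiv (hf : ContDiff ℝ (⊤ : ℕ∞) f)
    (h : ∀ β : Fin n → ℕ, ∃ (k : ℕ) (C : ℝ), ∀ x, ‖mderiv β f x‖ ≤ C * (1 + ‖x‖) ^ k) :
    f.HasTemperateGrowth := by
  refine ⟨hf, fun N => ?_⟩
  induction N generalizing f with
  | zero =>
    obtain ⟨k, C, hC⟩ := h 0
    exact ⟨k, C, fun x => by simpa [mderiv_zero] using hC x⟩
  | succ N ih =>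
    have hpd : ∀ i, ∃ (k : ℕ) (C : ℝ), ∀ x,
        ‖iteratedFDeriv ℝ N (pd i f) x‖ ≤ C * (1 + ‖x‖) ^ k := fun i =>
      ih (contDiff_pd i hf) fun β => by simpa only [mderiv_pd β i hf] using h (β + Pi.single i 1)
    choose k C hC using hpd
    let L : Fin n → ℂ →L[ℝ] (EuclideanSpace ℝ (Fin n) →L[ℝ] ℂ) := fun i =>
      ContinuousLinearMap.smulRightL ℝ (EuclideanSpace ℝ (Fin n)) ℂ (EuclideanSpace.proj i)
    refine ⟨Finset.univ.sup k, ∑ i, ‖L i‖ * |C i|, fun x => ?_⟩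
    have hN : ∀ i, ContDiff ℝ N (pd i f) := fun i =>
      (contDiff_pd i hf).of_le (mod_cast le_top)
    have hsum : fderiv ℝ f = ∑ i, L i ∘ pd i f := fderiv_eq_sum_pd f
    rw [← norm_iteratedFDeriv_fderiv, hsum,
      iteratedFDeriv_sum_apply fun i _ => ((L i).contDiff.comp (hN i)).contDiffAt, Finset.sum_mul]
    refine (norm_sum_le _ _).trans (Finset.sum_le_sum fun i _ => ?_)
    refine ((L i).norm_iteratedFDeriv_comp_left (hN i).contDiffAt le_rfl).trans ?_
    rw [mul_assoc]
    gcongr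
    calc ‖iteratedFDeriv ℝ N (pd i f) x‖ ≤ C i * (1 + ‖x‖) ^ k i := hC i x
      _ ≤ |C i| * (1 + ‖x‖) ^ Finset.univ.sup k := by
        gcongr
        · exact le_abs_self _
        · simp
        · exact Finset.le_sup (Finset.mem_univ i)

/-- Partial derivatives of multipliers of the Schwartz space are multipliers. -/
theorem exists_schwartzMap_pd_mul (hf : ContDiff ℝ (⊤ : ℕ∞) f)
    (h : ∀ ψ : SchwartzMap (EuclideanSpace ℝ (Fin n)) ℂ,
      ∃ φ : SchwartzMap (EuclideanSpace ℝ (Fin n)) ℂ, ∀ x, f x * ψ x = φ x) (i : Fin n)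
    (ψ : SchwartzMap (EuclideanSpace ℝ (Fin n)) ℂ) :
    ∃ φ : SchwartzMap (EuclideanSpace ℝ (Fin n)) ℂ, ∀ x, pd i f x * ψ x = φ x := by
  let e : EuclideanSpace ℝ (Fin n) := EuclideanSpace.single i 1
  obtain ⟨φ₁, h₁⟩ := h ψ
  obtain ⟨φ₂, h₂⟩ := h (LineDeriv.lineDerivOp e ψ)
  refine ⟨LineDeriv.lineDerivOp e φ₁ - φ₂, fun x => ?_⟩
  have hprod : (φ₁ : EuclideanSpace ℝ (Fin n) → ℂ) = fun x => f x * ψ x :=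
    funext fun x => (h₁ x).symm
  rw [sub_apply, ← h₂, SchwartzMap.lineDerivOp_apply_eq_fderiv,
    SchwartzMap.lineDerivOp_apply_eq_fderiv, hprod,
    fderiv_fun_mul (hf.differentiable (by simp) x) ψ.differentiableAt]
  simp [pd, e, mul_comm]

end PartialDerivatives

/-- A smooth function `m : ℝⁿ → ℂ` is a multiplier of the Schwartz space if and only if it
has temperate growth; in symbols `m(ℝⁿ) = O_M(ℝⁿ)`. -/
theorem multiplier_iff_OM (n : ℕ) (m : EuclideanSpace ℝ (Fin n) → ℂ)
    (hm : ContDiff ℝ (⊤ : ℕ∞) m) :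
    (∀ ψ : SchwartzMap (EuclideanSpace ℝ (Fin n)) ℂ,
      ∃ φ : SchwartzMap (EuclideanSpace ℝ (Fin n)) ℂ, ∀ x, m x * ψ x = φ x) ↔
    (∀ β : Fin n → ℕ, ∃ (α : ℕ) (C : ℝ), ∀ x,
      ‖mderiv β m x‖ ≤ C * (1 + ‖x‖^2) ^ ((α:ℝ)/2)) := by
  simp only [exists_le_mul_one_add_norm_sq_rpow_iff]
  constructor
  · intro h β
    have hmult := (mderiv_induction
      (fun g => ContDiff ℝ (⊤ : ℕ∞) g ∧ ∀ ψ : SchwartzMap (EuclideanSpace ℝ (Fin n)) ℂ,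
        ∃ φ : SchwartzMap (EuclideanSpace ℝ (Fin n)) ℂ, ∀ x, g x * ψ x = φ x)
      (fun i _ hg => ⟨contDiff_pd i hg.1, exists_schwartzMap_pd_mul hg.1 hg.2 i⟩) β ⟨hm, h⟩).2
    refine exists_norm_le_mul_one_add_norm_pow _ fun ψ => ?_
    obtain ⟨φ, hφ⟩ := hmult ψ
    exact ⟨_, fun x => (hφ x).symm ▸ φ.norm_le_seminorm ℝ x⟩
  · intro h ψ
    have hg := hasTemperateGrowth_of_mderiv hm h
    exact ⟨SchwartzMap.smulLeftCLM ℂ m ψ, fun x =>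
      (SchwartzMap.smulLeftCLM_apply_apply hg ψ x).symm⟩
end
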